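/- Let (α_n, β_n) be a Bailey pair relative to a = 1 (β_n = ∑_{k=0}^n α_k/((q;q)_{n-k}(q;q)_{n+k})), with suitable convergence. Then ∑_{n=0}^{∞} q^{n(n+1)/2} (−1; q)_n β_n = [2 (−q;q)_∞ / (q;q)_∞] ∑_{n=0}^{∞} [q^{n(n+1)/2} / (1 + q^n)] α_n. -/

import Mathlib

noncomputable def qp (q x : ℂ) (n : ℕ) : ℂ := ∏ i ∈ Finset.range n, (1 - x * q ^ i)

noncomputable def qpInf (q x : ℂ) : ℂ := ∏' i : ℕ, (1 - x * q ^ i)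

open Filter Topology

lemma qp_zero' (q x : ℂ) : qp q x 0 = 1 := by simp [qp]

lemma qp_succ' (q x : ℂ) (n : ℕ) : qp q x (n + 1) = qp q x n * (1 - x * q ^ n) := by
  simp [qp, Finset.prod_range_succ]

lemma qp_add' (q x : ℂ) (k n : ℕ) : qp q x (k + n) = qp q x k * qp q (x * q ^ k) n := by
  simp only [qp, Finset.prod_range_add]
  congr 1
  refine Finset.prod_congr rfl fun i _ => ?_
  rw [pow_add]; ring

lemma geom_bd (r : ℝ) (h0 : 0 ≤ r) (h1 : r < 1) (m : ℕ) :
    ∑ i ∈ Finset.range m, r ^ i ≤ 1 / (1 - r) := by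
  have := (summable_geometric_of_lt_one h0 h1).sum_le_tsum (Finset.range m)
    (fun i _ => pow_nonneg h0 i)
  rwa [tsum_geometric_of_lt_one h0 h1, ← one_div] at this

lemma qp_upper (q x : ℂ) (h1 : ‖q‖ < 1) (hx : ‖x‖ ≤ 1) (m : ℕ) :
    ‖qp q x m‖ ≤ Real.exp (1 / (1 - ‖q‖)) := by
  rw [qp, norm_prod]
  calc ∏ i ∈ Finset.range m, ‖1 - x * q ^ i‖
      ≤ ∏ i ∈ Finset.range m, (1 + ‖q‖ ^ i) := by
        refine Finset.prod_le_prod (fun _ _ => norm_nonneg _) fun i _ => ?_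
        refine (norm_sub_le _ _).trans ?_
        rw [norm_one, norm_mul, norm_pow]
        have := mul_le_mul_of_nonneg_right hx (pow_nonneg (norm_nonneg q) i)
        linarith
    _ ≤ Real.exp (∑ i ∈ Finset.range m, ‖q‖ ^ i) :=
        Real.prod_one_add_le_exp_sum _ (fun i => by positivity)
    _ ≤ _ := Real.exp_le_exp.2 (geom_bd _ (norm_nonneg _) h1 m)

lemma qp_lower (q x : ℂ) (h1 : ‖q‖ < 1) (hx : ‖x‖ ≤ ‖q‖) (m : ℕ) :
    Real.exp (-(1 / (1 - ‖q‖) / (1 - ‖q‖))) ≤ ‖qp q x m‖ := by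
  rw [qp, norm_prod]
  have hr : 0 < 1 - ‖q‖ := by linarith
  calc Real.exp (-(1 / (1 - ‖q‖) / (1 - ‖q‖)))
      ≤ Real.exp (∑ i ∈ Finset.range m, (-(‖q‖ ^ i / (1 - ‖q‖)))) := by
        rw [Real.exp_le_exp, Finset.sum_neg_distrib, neg_le_neg_iff, ← Finset.sum_div]
        gcongr
        exact geom_bd _ (norm_nonneg _) h1 m
    _ = ∏ i ∈ Finset.range m, Real.exp (-(‖q‖ ^ i / (1 - ‖q‖))) := Real.exp_sum _ _
    _ ≤ _ := by
        refine Finset.prod_le_prod (fun _ _ => (Real.exp_pos _).le) fun i _ => ?_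
        have hp : 0 ≤ ‖q‖ ^ i := pow_nonneg (norm_nonneg q) i
        have hp1 : ‖q‖ ^ i ≤ 1 := pow_le_one₀ (norm_nonneg q) h1.le
        have hy : ‖x * q ^ i‖ ≤ ‖q‖ * ‖q‖ ^ i := by
          rw [norm_mul, norm_pow]; gcongr
        have h2 : 1 - ‖q‖ * ‖q‖ ^ i ≤ ‖1 - x * q ^ i‖ := by
          have := norm_sub_norm_le (1 : ℂ) (x * q ^ i)
          rw [norm_one] at this; linarith
        refine le_trans ?_ h2
        rw [Real.exp_neg]
        have h3 : 0 < 1 - ‖q‖ * ‖q‖ ^ i := by nlinarith [norm_nonneg q]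
        refine inv_le_of_inv_le₀ h3 (le_trans ?_ (Real.add_one_le_exp _))
        rw [inv_le_iff_one_le_mul₀ h3]
        have h4 : (‖q‖ ^ i / (1 - ‖q‖) + 1) * (1 - ‖q‖ * ‖q‖ ^ i) =
          1 + (‖q‖ ^ i / (1 - ‖q‖)) * (1 - ‖q‖ * ‖q‖ ^ i - ‖q‖ * (1 - ‖q‖)) := by
          field_simp; ring
        rw [h4]
        have : 0 ≤ (‖q‖ ^ i / (1 - ‖q‖)) * (1 - ‖q‖ * ‖q‖ ^ i - ‖q‖ * (1 - ‖q‖)) := by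
          apply mul_nonneg (by positivity)
          nlinarith [norm_nonneg q]
        linarith

lemma qp_ne (q x : ℂ) (h1 : ‖q‖ < 1) (hx : ‖x‖ ≤ ‖q‖) (m : ℕ) : qp q x m ≠ 0 :=
  norm_pos_iff.1 ((Real.exp_pos _).trans_le (qp_lower q x h1 hx m))

lemma qp_tendsto (q x : ℂ) (h1 : ‖q‖ < 1) :
    Tendsto (qp q x) atTop (𝓝 (qpInf q x)) := by
  have hs : Summable fun i : ℕ => -(x * q ^ i) :=
    ((summable_geometric_of_norm_lt_one h1).mul_left x).neg
  have := (Complex.multipliable_one_add_of_summable hs).tendsto_prod_tprod_nat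
  simp only [← sub_eq_add_neg] at this
  exact this

lemma qpInf_ne (q x : ℂ) (h1 : ‖q‖ < 1) (hx : ‖x‖ ≤ ‖q‖) : qpInf q x ≠ 0 :=
  norm_pos_iff.1 ((Real.exp_pos _).trans_le
    (ge_of_tendsto' (qp_tendsto q x h1).norm (qp_lower q x h1 hx)))

lemma qpInf_split (q x : ℂ) (h1 : ‖q‖ < 1) (k : ℕ) :
    qpInf q x = qp q x k * qpInf q (x * q ^ k) := by
  have h := (qp_tendsto q x h1).comp (tendsto_add_atTop_nat k)
  refine tendsto_nhds_unique h ?_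
  refine ((qp_tendsto q (x * q ^ k) h1).const_mul (qp q x k)).congr fun n => ?_
  rw [← qp_add', Function.comp, add_comm]

lemma tri_succ (m : ℕ) : (m + 1) * (m + 1 + 1) / 2 = m * (m + 1) / 2 + (m + 1) := by
  rw [show (m + 1) * (m + 1 + 1) = m * (m + 1) + (m + 1) * 2 by ring,
    Nat.add_mul_div_right _ _ (by norm_num)]

lemma tri_add (k m : ℕ) :
    (k + m) * (k + m + 1) / 2 = k * (k + 1) / 2 + m * (m + 1) / 2 + k * m := by
  induction m with
  | zero => simp
  | succ m ih => rw [← add_assoc, tri_succ, ih, tri_succ]; ring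

/-- Summand of the basic hypergeometric series. -/
noncomputable def tt (q b w : ℂ) (m : ℕ) : ℂ :=
  qp q (-b) m / (qp q q m * qp q (b * q * w) m) * (w ^ m * q ^ (m * (m + 1) / 2))

lemma tri_ge (m : ℕ) : m ≤ m * (m + 1) / 2 := by
  cases m with
  | zero => simp
  | succ m => rw [tri_succ]; omega

lemma frac_bd (q a c : ℂ) (h1 : ‖q‖ < 1) (ha : ‖a‖ ≤ 1) (hc : ‖c‖ ≤ ‖q‖) (n m k : ℕ) :
    ‖qp q a n / (qp q q m * qp q c k)‖ ≤ Real.exp (1 / (1 - ‖q‖)) /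
      (Real.exp (-(1 / (1 - ‖q‖) / (1 - ‖q‖))) * Real.exp (-(1 / (1 - ‖q‖) / (1 - ‖q‖)))) := by
  rw [norm_div, norm_mul]
  have := qp_upper q a h1 ha n
  have := qp_lower q q h1 le_rfl m
  have := qp_lower q c h1 hc k
  gcongr

lemma bqw (q b w : ℂ) (hb : ‖b‖ ≤ 1) (hw : ‖w‖ ≤ 1) : ‖b * q * w‖ ≤ ‖q‖ := by
  rw [norm_mul, norm_mul]
  calc ‖b‖ * ‖q‖ * ‖w‖ ≤ 1 * ‖q‖ * 1 := by gcongr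
    _ = ‖q‖ := by ring

lemma tt_bd (q : ℂ) (h1 : ‖q‖ < 1) : ∃ C : ℝ, ∀ b w : ℂ, ‖b‖ ≤ 1 → ‖w‖ ≤ 1 → ∀ m,
    ‖tt q b w m‖ ≤ C * ‖q‖ ^ m := by
  refine ⟨Real.exp (1 / (1 - ‖q‖)) / (Real.exp (-(1 / (1 - ‖q‖) / (1 - ‖q‖))) *
    Real.exp (-(1 / (1 - ‖q‖) / (1 - ‖q‖)))), fun b w hb hw m => ?_⟩
  rw [tt, norm_mul]
  refine mul_le_mul (frac_bd q (-b) _ h1 (by simpa) (bqw q b w hb hw) m m m) ?_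
    (norm_nonneg _) (by positivity)
  rw [norm_mul, norm_pow, norm_pow]
  calc ‖w‖ ^ m * ‖q‖ ^ (m * (m + 1) / 2) ≤ 1 * ‖q‖ ^ m := by
        gcongr ?_ * ?_
        · exact pow_le_one₀ (norm_nonneg _) hw
        · exact pow_le_pow_of_le_one (norm_nonneg _) h1.le (tri_ge m)
    _ = _ := one_mul _

lemma tt_summable (q b w : ℂ) (h1 : ‖q‖ < 1) (hb : ‖b‖ ≤ 1) (hw : ‖w‖ ≤ 1) :
    Summable (tt q b w) := by
  obtain ⟨C, hC⟩ := tt_bd q h1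
  exact Summable.of_norm_bounded
    ((summable_geometric_of_lt_one (norm_nonneg _) h1).mul_left C) (hC b w hb hw)

lemma one_sub_ne (x : ℂ) (hx : ‖x‖ < 1) : 1 - x ≠ 0 := by
  intro h
  rw [← sub_eq_zero.1 h, norm_one] at hx
  exact lt_irrefl _ hx

lemma mul_pow_lt (q x : ℂ) (h1 : ‖q‖ < 1) (hx : ‖x‖ ≤ ‖q‖) (m : ℕ) : ‖x * q ^ m‖ < 1 := by
  rw [norm_mul, norm_pow]
  calc ‖x‖ * ‖q‖ ^ m ≤ ‖q‖ * 1 := by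
        gcongr
        exact pow_le_one₀ (norm_nonneg q) h1.le
    _ < 1 := by linarith

lemma tt_rec (q b w : ℂ) (h1 : ‖q‖ < 1) (hb : ‖b‖ ≤ 1) (hw : ‖w‖ ≤ 1) (m : ℕ) :
    tt q b w m * (1 - b * q * w) - (1 + q * w) * tt q b (w * q) m =
      (1 - b * q * w) * ((1 - q ^ m) * tt q b w m - (1 - q ^ (m + 1)) * tt q b w (m + 1)) := by
  have hB := bqw q b w hb hw
  have e1 := qp_ne q q h1 le_rfl m
  have e2 := qp_ne q _ h1 hB m
  have e3 := one_sub_ne _ (mul_pow_lt q q h1 le_rfl m)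
  have e4 := one_sub_ne _ (mul_pow_lt q _ h1 hB m)
  have e5 := one_sub_ne _ (hB.trans_lt h1)
  have hD : qp q (b * q * (w * q)) m =
      qp q (b * q * w) m * (1 - b * q * w * q ^ m) / (1 - b * q * w) := by
    rw [← qp_succ', add_comm m 1, qp_add', qp_succ', qp_zero', eq_div_iff (by simpa using e5)]
    simp only [pow_zero, pow_one, mul_one, one_mul, ← mul_assoc]
    ring
  simp only [tt]
  rw [hD, qp_succ', qp_succ', qp_succ', tri_succ, mul_pow, pow_add q _ (m + 1), pow_succ q m,
    pow_succ w m, mul_comm (q ^ m) q]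
  generalize qp q q m = A at *
  generalize qp q (b * q * w) m = D at *
  generalize qp q (-b) m = N at *
  generalize q ^ (m * (m + 1) / 2) = Q at *
  generalize q ^ m = y at *
  generalize w ^ m = W at *
  field_simp
  ring

lemma tt_fe (q b w : ℂ) (h1 : ‖q‖ < 1) (hb : ‖b‖ ≤ 1) (hw : ‖w‖ ≤ 1) :
    (∑' m, tt q b w m) * (1 - b * q * w) = (1 + q * w) * ∑' m, tt q b (w * q) m := by
  have hw' : ‖w * q‖ ≤ 1 := by
    rw [norm_mul]; exact mul_le_one₀ hw (norm_nonneg _) h1.le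
  have s1 := tt_summable q b w h1 hb hw
  have s2 := tt_summable q b _ h1 hb hw'
  have sG : Summable fun m => (1 - q ^ m) * tt q b w m := by
    refine Summable.of_norm_bounded (s1.norm.mul_left 2) fun m => ?_
    rw [norm_mul]
    gcongr
    refine (norm_sub_le _ _).trans ?_
    rw [norm_one, norm_pow]
    have := pow_le_one₀ (norm_nonneg q) h1.le (n := m)
    linarith
  have sG' := (summable_nat_add_iff 1).2 sG
  rw [← sub_eq_zero, ← tsum_mul_right, ← tsum_mul_left,
    ← (s1.mul_right _).tsum_sub (s2.mul_left _)]
  simp only [tt_rec q b w h1 hb hw]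
  rw [tsum_mul_left, sG.tsum_sub sG', sG.tsum_eq_zero_add]
  simp

lemma tt_iter (q b w : ℂ) (h1 : ‖q‖ < 1) (hb : ‖b‖ ≤ 1) (hw : ‖w‖ ≤ 1) (N : ℕ) :
    (∑' m, tt q b w m) * qp q (b * q * w) N =
      qp q (-(q * w)) N * ∑' m, tt q b (w * q ^ N) m := by
  induction N with
  | zero => simp [qp_zero']
  | succ N ih =>
    have hw' : ‖w * q ^ N‖ ≤ 1 := by
      rw [norm_mul, norm_pow]
      exact mul_le_one₀ hw (by positivity) (pow_le_one₀ (norm_nonneg _) h1.le)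
    have := tt_fe q b _ h1 hb hw'
    rw [qp_succ', qp_succ', ← mul_assoc, ih, pow_succ, ← mul_assoc w]
    linear_combination qp q (-(q * w)) N * this

lemma tt_sum (q b w : ℂ) (h1 : ‖q‖ < 1) (hb : ‖b‖ ≤ 1) (hw : ‖w‖ ≤ 1) :
    ∑' m, tt q b w m = qpInf q (-(q * w)) / qpInf q (b * q * w) := by
  rw [eq_div_iff (qpInf_ne q _ h1 (bqw q b w hb hw))]
  have hwN : ∀ N, ‖w * q ^ N‖ ≤ 1 := fun N => by
    rw [norm_mul, norm_pow]
    exact mul_le_one₀ hw (by positivity) (pow_le_one₀ (norm_nonneg _) h1.le)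
  have hz : Tendsto (fun N : ℕ => w * q ^ N) atTop (𝓝 0) := by
    simpa using (tendsto_pow_atTop_nhds_zero_of_norm_lt_one h1).const_mul w
  obtain ⟨C, hC⟩ := tt_bd q h1
  have hlim : Tendsto (fun N : ℕ => ∑' m, tt q b (w * q ^ N) m) atTop
      (𝓝 (∑' m, tt q b 0 m)) := by
    refine tendsto_tsum_of_dominated_convergence
      ((summable_geometric_of_lt_one (norm_nonneg _) h1).mul_left C) (fun m => ?_)
      (Eventually.of_forall fun N m => hC b _ hb (hwN N) m)
    have hc : ContinuousAt (fun z => tt q b z m) 0 := by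
      have : qp q q m * qp q (b * q * 0) m ≠ 0 :=
        mul_ne_zero (qp_ne q q h1 le_rfl m) (qp_ne q _ h1 (by simp) m)
      have hcq : Continuous fun z => qp q (b * q * z) m := by
        unfold qp; fun_prop
      unfold tt
      exact ((continuousAt_const).div (continuousAt_const.mul hcq.continuousAt) this).mul
        (by fun_prop)
    exact hc.tendsto.comp hz
  have h0 : ∑' m, tt q b 0 m = 1 := by
    rw [tsum_eq_single 0]
    · simp [tt, qp_zero']
    · intro m hm; simp [tt, hm]
  rw [h0] at hlim
  have hL := (qp_tendsto q (b * q * w) h1).const_mul (∑' m, tt q b w m)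
  have hR := (qp_tendsto q (-(q * w)) h1).mul hlim
  simp only [tt_iter q b w h1 hb hw] at hL
  simpa using tendsto_nhds_unique hL hR

/-- The double-series kernel. -/
noncomputable def kk (q : ℂ) (k m : ℕ) : ℂ :=
  q ^ ((k + m) * (k + m + 1) / 2) * qp q (-1) (k + m) / (qp q q m * qp q q (k + m + k))

lemma kk_eq (q : ℂ) (k m : ℕ) :
    kk q k m = q ^ (k * (k + 1) / 2) * qp q (-1) k / qp q q (2 * k) *
      tt q (q ^ k) (q ^ k) m := by
  have e : qp q q (k + m + k) = qp q q (2 * k) * qp q (q ^ k * q * q ^ k) m := by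
    rw [show k + m + k = 2 * k + m by ring, qp_add']
    congr 2; ring
  rw [kk, tt, e, tri_add, qp_add', neg_one_mul, pow_add, pow_add, pow_mul]
  simp only [div_eq_mul_inv, mul_inv]
  ring

lemma one_add_pow_ne (q : ℂ) (h1 : ‖q‖ < 1) (k : ℕ) : 1 + q ^ k ≠ 0 := by
  cases k with
  | zero => norm_num
  | succ k =>
    have := one_sub_ne (-q * q ^ k) (mul_pow_lt q (-q) h1 (by simp) k)
    rw [pow_succ]
    convert this using 1
    ring

lemma kk_sum (q : ℂ) (h1 : ‖q‖ < 1) (k : ℕ) :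
    ∑' m, kk q k m = 2 * qpInf q (-q) / qpInf q q * (q ^ (k * (k + 1) / 2) / (1 + q ^ k)) := by
  have hk : ‖q ^ k‖ ≤ 1 := by rw [norm_pow]; exact pow_le_one₀ (norm_nonneg _) h1.le
  simp only [kk_eq]
  rw [tsum_mul_left, tt_sum q _ _ h1 hk hk, qpInf_split q (-q) h1 k, qpInf_split q q h1 (2 * k)]
  have a1 : qp q (-1) k * (1 + q ^ k) = 2 * qp q (-q) k := by
    have : qp q (-1) (k + 1) = qp q (-1) (1 + k) := by rw [add_comm]
    rw [qp_succ', qp_add', qp_succ', qp_zero'] at this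
    simp only [pow_zero, pow_one, mul_one, one_mul, neg_mul, sub_neg_eq_add] at this
    rw [this]; norm_num
  have n1 := one_add_pow_ne q h1 k
  have n2 := qp_ne q q h1 le_rfl (2 * k)
  have n3 : qpInf q (q * q ^ (2 * k)) ≠ 0 := by
    have := qpInf_ne q q h1 le_rfl
    rw [qpInf_split q q h1 (2 * k)] at this
    exact right_ne_zero_of_mul this
  rw [show q ^ k * q * q ^ k = q * q ^ (2 * k) by ring, show -(q * q ^ k) = -q * q ^ k by ring]
  field_simp
  linear_combination q ^ (k * (k + 1) / 2) * qpInf q (-(q * q ^ k)) * a1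

theorem stmt14 (q : ℂ) (h0 : 0 < ‖q‖) (h1 : ‖q‖ < 1) (α β : ℕ → ℂ)
    (hpair : ∀ n : ℕ, β n = ∑ k ∈ Finset.range (n + 1),
        α k / (qp q q (n - k) * qp q q (n + k)))
    (hα : Summable fun n : ℕ => q ^ (n * (n + 1) / 2) / (1 + q ^ n) * α n)
    (hβ : Summable fun n : ℕ => q ^ (n * (n + 1) / 2) * qp q (-1) n * β n) :
    ∑' n : ℕ, q ^ (n * (n + 1) / 2) * qp q (-1) n * β n
      = 2 * qpInf q (-q) / qpInf q q *
          ∑' n : ℕ, q ^ (n * (n + 1) / 2) / (1 + q ^ n) * α n := by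
  have hA : Summable fun n : ℕ => ‖q ^ (n * (n + 1) / 2) * α n‖ := by
    refine Summable.of_nonneg_of_le (fun _ => norm_nonneg _) (fun n => ?_) (hα.norm.mul_left 2)
    have e : q ^ (n * (n + 1) / 2) * α n =
        (1 + q ^ n) * (q ^ (n * (n + 1) / 2) / (1 + q ^ n) * α n) := by
      have := one_add_pow_ne q h1 n
      field_simp
    rw [e, norm_mul]
    gcongr
    refine (norm_add_le _ _).trans ?_
    rw [norm_one, norm_pow]
    have := pow_le_one₀ (norm_nonneg q) h1.le (n := n)
    linarith
  have hsum : Summable fun p : ℕ × ℕ => α p.1 * kk q p.1 p.2 := by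
    have hg := summable_geometric_of_lt_one (norm_nonneg q) h1
    have hm := (hA.mul_of_nonneg hg (fun _ => norm_nonneg _) (fun _ => by positivity)).mul_left
      (Real.exp (1 / (1 - ‖q‖)) / (Real.exp (-(1 / (1 - ‖q‖) / (1 - ‖q‖))) *
        Real.exp (-(1 / (1 - ‖q‖) / (1 - ‖q‖)))))
    refine Summable.of_norm_bounded hm fun p => ?_
    obtain ⟨k, m⟩ := p
    have e : α k * kk q k m = qp q (-1) (k + m) / (qp q q m * qp q q (k + m + k)) *
        ((q ^ (k * (k + 1) / 2) * α k) * q ^ (m * (m + 1) / 2 + k * m)) := by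
      rw [kk, tri_add, add_assoc, pow_add]; ring
    simp only
    rw [e, norm_mul, norm_mul (q ^ (k * (k + 1) / 2) * α k), norm_pow]
    have b1 := frac_bd q (-1) q h1 (by simp) le_rfl (k + m) m (k + m + k)
    have b2 : ‖q‖ ^ (m * (m + 1) / 2 + k * m) ≤ ‖q‖ ^ m :=
      pow_le_pow_of_le_one (norm_nonneg _) h1.le ((tri_ge m).trans (Nat.le_add_right _ _))
    gcongr
  have hL : ∀ n : ℕ, q ^ (n * (n + 1) / 2) * qp q (-1) n * β n =
      ∑ p ∈ Finset.HasAntidiagonal.antidiagonal n, α p.1 * kk q p.1 p.2 := by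
    intro n
    rw [Finset.Nat.sum_antidiagonal_eq_sum_range_succ (fun k m => α k * kk q k m) n, hpair,
      Finset.mul_sum]
    refine Finset.sum_congr rfl fun k hk => ?_
    have hkn : k + (n - k) = n := by
      have := Finset.mem_range.1 hk
      omega
    rw [kk, hkn]
    ring
  simp only [hL]
  have hs' := Finset.HasAntidiagonal.sigmaAntidiagonalEquivProd.summable_iff.2 hsum
  have e1 : ∑' n : ℕ, ∑ p ∈ Finset.HasAntidiagonal.antidiagonal n, α p.1 * kk q p.1 p.2 =
      ∑' p : ℕ × ℕ, α p.1 * kk q p.1 p.2 := by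
    rw [← Finset.HasAntidiagonal.sigmaAntidiagonalEquivProd.tsum_eq
      (fun p : ℕ × ℕ => α p.1 * kk q p.1 p.2)]
    refine Eq.trans ?_ (hs'.tsum_sigma' fun n => (hasSum_fintype _).summable).symm
    refine tsum_congr fun n => ?_
    rw [tsum_fintype]
    exact (Finset.sum_coe_sort (Finset.HasAntidiagonal.antidiagonal n)
      (fun p : ℕ × ℕ => α p.1 * kk q p.1 p.2)).symm
  rw [e1, hsum.tsum_prod, ← tsum_mul_left]
  refine tsum_congr fun k => ?_
  simp only
  rw [tsum_mul_left, kk_sum q h1]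
  ring
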